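/- arXiv:2002.00027 — 2 statements merged into one kernel-verified Lean document; each statement's English description precedes it below -/
import Mathlib

section
/- For every initial state x(0) ∈ {−1,+1}^N, the sequence defined by x(t+1) = T(x(t)) is eventually constant: there exists t₀ such that x(t) = x(t₀) for all t ≥ t₀, and x(t₀) is a fixed point of T. In other words, the bipolar recurrent correlation neural network with synchronous update always settles at an equilibrium. -/
open scoped Classical

/-- Correlation of the state `x` with the `ξ`-th fundamental memory. -/
noncomputable def overlap {N P : ℕ} (u : Fin P → Fin N → ℝ) (x : Fin N → ℝ) (ξ : Fin P) : ℝ :=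
  ∑ i, u ξ i * x i

/-- Activation potential of the `i`-th neuron: `h_i(x) = Σ_ξ f(Σ_j u_j^ξ x_j) u_i^ξ`. -/
noncomputable def pot {N P : ℕ} (f : ℝ → ℝ) (u : Fin P → Fin N → ℝ) (x : Fin N → ℝ)
    (i : Fin N) : ℝ :=
  ∑ ξ, f (overlap u x ξ) * u ξ i

/-- Synchronous update of the bipolar recurrent correlation neural network. -/
noncomputable def upd {N P : ℕ} (f : ℝ → ℝ) (u : Fin P → Fin N → ℝ) (x : Fin N → ℝ) :
    Fin N → ℝ :=
  fun i => if pot f u x i ≠ 0 then Real.sign (pot f u x i) else x i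

/-- Energy of the bipolar recurrent correlation neural network. -/
noncomputable def energy {N P : ℕ} (F : ℝ → ℝ) (u : Fin P → Fin N → ℝ) (x : Fin N → ℝ) : ℝ :=
  -∑ ξ, F (overlap u x ξ)

theorem aux_grad (f F : ℝ → ℝ) (hmono : Monotone f)
    (hF : ∀ t : ℝ, HasDerivAt F (f t) t) (a b : ℝ) : f a * (b - a) ≤ F b - F a := by
  have hc : Continuous F := continuous_iff_continuousAt.2 fun t => (hF t).continuousAt
  rcases lt_trichotomy a b with h | h | h
  · obtain ⟨c, hc1, hc2⟩ := exists_hasDerivAt_eq_slope F f h hc.continuousOn (fun x _ => hF x)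
    have hba : 0 < b - a := sub_pos.2 h
    rw [eq_div_iff hba.ne'] at hc2
    rw [← hc2]
    exact mul_le_mul_of_nonneg_right (hmono hc1.1.le) hba.le
  · simp [h]
  · obtain ⟨c, hc1, hc2⟩ := exists_hasDerivAt_eq_slope F f h hc.continuousOn (fun x _ => hF x)
    have hba : 0 < a - b := sub_pos.2 h
    rw [eq_div_iff hba.ne'] at hc2
    have := mul_le_mul_of_nonneg_right (hmono hc1.2.le) hba.le
    linarith

theorem aux_bip {N P : ℕ} (f : ℝ → ℝ) (u : Fin P → Fin N → ℝ) (x : Fin N → ℝ)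
    (hx : ∀ i, x i = 1 ∨ x i = -1) (i : Fin N) : upd f u x i = 1 ∨ upd f u x i = -1 := by
  unfold upd
  split_ifs with h
  · rcases lt_or_gt_of_ne h with h | h
    · right; exact Real.sign_of_neg h
    · left; exact Real.sign_of_pos h
  · exact hx i

theorem aux_term {N P : ℕ} (f : ℝ → ℝ) (u : Fin P → Fin N → ℝ) (x : Fin N → ℝ)
    (hx : ∀ i, x i = 1 ∨ x i = -1) (i : Fin N) :
    0 ≤ pot f u x i * (upd f u x i - x i) ∧
    (upd f u x i ≠ x i → 0 < pot f u x i * (upd f u x i - x i)) := by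
  unfold upd
  split_ifs with h
  · rcases lt_or_gt_of_ne h with h | h
    · rw [Real.sign_of_neg h]
      rcases hx i with h1 | h1 <;> rw [h1]
      · exact ⟨by linarith, fun _ => by linarith⟩
      · simp
    · rw [Real.sign_of_pos h]
      rcases hx i with h1 | h1 <;> rw [h1]
      · simp
      · exact ⟨by linarith, fun _ => by linarith⟩
  · simp

theorem aux_energy {N P : ℕ} (f F : ℝ → ℝ) (hmono : Monotone f)
    (hF : ∀ t : ℝ, HasDerivAt F (f t) t) (u : Fin P → Fin N → ℝ) (x : Fin N → ℝ)
    (hx : ∀ i, x i = 1 ∨ x i = -1) (hne : upd f u x ≠ x) :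
    energy F u (upd f u x) < energy F u x := by
  have h1 : 0 < ∑ i, pot f u x i * (upd f u x i - x i) := by
    obtain ⟨i, hi⟩ := Function.ne_iff.1 hne
    exact Finset.sum_pos' (fun i _ => (aux_term f u x hx i).1)
      ⟨i, Finset.mem_univ _, (aux_term f u x hx i).2 hi⟩
  have h2 : ∑ i, pot f u x i * (upd f u x i - x i) =
      ∑ ξ, f (overlap u x ξ) * (overlap u (upd f u x) ξ - overlap u x ξ) := by
    generalize upd f u x = y
    have : ∀ ξ, overlap u y ξ - overlap u x ξ = ∑ i, u ξ i * (y i - x i) := by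
      intro ξ
      simp only [overlap, mul_sub, Finset.sum_sub_distrib]
    simp only [this, pot, Finset.sum_mul, Finset.mul_sum]
    rw [Finset.sum_comm]
    simp only [mul_assoc]
  have h3 := Finset.sum_le_sum (s := Finset.univ) fun ξ _ =>
    aux_grad f F hmono hF (overlap u x ξ) (overlap u (upd f u x) ξ)
  rw [Finset.sum_sub_distrib] at h3
  unfold energy
  linarith

/-- The bipolar RCNN with synchronous update always settles at an equilibrium. -/
theorem bipolar_sync_settles {N P : ℕ} (hN : 1 ≤ N) (hP : 1 ≤ P)
    (f F : ℝ → ℝ) (hf : Continuous f) (hmono : Monotone f)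
    (hF : ∀ t : ℝ, HasDerivAt F (f t) t)
    (u : Fin P → Fin N → ℝ) (hu : ∀ ξ i, u ξ i = 1 ∨ u ξ i = -1)
    (x₀ : Fin N → ℝ) (hx₀ : ∀ i, x₀ i = 1 ∨ x₀ i = -1) :
    ∃ t₀ : ℕ, upd f u ((upd f u)^[t₀] x₀) = (upd f u)^[t₀] x₀ ∧
      ∀ t : ℕ, t₀ ≤ t → (upd f u)^[t] x₀ = (upd f u)^[t₀] x₀ := by
  have hb : ∀ t : ℕ, ∀ i, (upd f u)^[t] x₀ i = 1 ∨ (upd f u)^[t] x₀ i = -1 := by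
    intro t
    induction t with
    | zero => exact hx₀
    | succ t ih =>
      rw [Function.iterate_succ_apply']
      exact aux_bip f u _ ih
  have hex : ∃ t₀ : ℕ, upd f u ((upd f u)^[t₀] x₀) = (upd f u)^[t₀] x₀ := by
    by_contra hcon
    have hcon' : ∀ t : ℕ, upd f u ((upd f u)^[t] x₀) ≠ (upd f u)^[t] x₀ :=
      fun t h => hcon ⟨t, h⟩
    have hanti : StrictAnti fun t : ℕ => energy F u ((upd f u)^[t] x₀) := by
      apply strictAnti_nat_of_succ_lt
      intro t
      rw [Function.iterate_succ_apply']
      exact aux_energy f F hmono hF u _ (hb t) (hcon' t)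
    have hinj : Function.Injective fun t : ℕ => (upd f u)^[t] x₀ := by
      intro a b hab
      exact hanti.injective (congrArg (energy F u) hab)
    have hfin : (Set.univ.pi fun _ : Fin N => ({1, -1} : Set ℝ)).Finite :=
      Set.Finite.pi' (fun _ => Set.toFinite _) |>.subset (fun x hx i => hx i (Set.mem_univ i))
    exact Set.infinite_range_of_injective hinj
      (hfin.subset (by rintro _ ⟨t, rfl⟩ i _; exact hb t i))
  obtain ⟨t₀, ht⟩ := hex
  refine ⟨t₀, ht, fun t h => ?_⟩
  induction t, h using Nat.le_induction with
  | base => rfl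
  | succ t _ ih => rw [Function.iterate_succ_apply', ih, ht]
end

section
/- The function p ↦ csgn(conj(p)) is a B-function with respect to the hyperbolic (Minkowski) bilinear form: for every z ∈ ℂ with conj(z) ∈ D and every s ∈ S with s ≠ csgn(conj(z)), one has B_h(csgn(conj(z)), z) > B_h(s, z), where B_h(p,q) = p₀q₀ − p₁q₁ for p = p₀ + p₁ i and q = q₀ + q₁ i. Consequently the hyperbolic-valued recurrent correlation neural network with this modified activation function always settles at an equilibrium. -/
open scoped Classical

/-- The argument of a complex number taken in `[0, 2π)`. -/
noncomputable def arg2pi (z : ℂ) : ℝ :=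
  if Complex.arg z < 0 then Complex.arg z + 2 * Real.pi else Complex.arg z

/-- The domain `D` of the complex-valued multistate signum function: nonzero complex
numbers whose argument (in `[0, 2π)`) differs from `(2k-1)·Δθ` for all `k = 1,…,K`,
where `Δθ = π/K`. -/
def Dset (K : ℕ) : Set ℂ :=
  {z | z ≠ 0 ∧ ∀ k : ℕ, 1 ≤ k → k ≤ K → arg2pi z ≠ (2 * (k : ℝ) - 1) * (Real.pi / K)}

/-- The set `S = {e^{2kΔθ·i} : k = 0,…,K-1}` of `K`-th roots of unity, `Δθ = π/K`. -/
def Sset (K : ℕ) : Set ℂ :=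
  {s | ∃ k : ℕ, k < K ∧ s = Complex.exp ((2 * (k : ℝ) * (Real.pi / K) : ℝ) * Complex.I)}

/-- `csgn` is a complex-valued multistate signum function with resolution factor `K`:
for every `z ∈ D`, `csgn z` is the element `s ∈ S` such that the argument of
`z · conj s` lies in the open interval `(-Δθ, Δθ)` modulo `2π`. -/
def IsCsgn (K : ℕ) (csgn : ℂ → ℂ) : Prop :=
  ∀ z ∈ Dset K, csgn z ∈ Sset K ∧
    Complex.arg (z * (starRingEnd ℂ) (csgn z)) ∈ Set.Ioo (-(Real.pi / K)) (Real.pi / K)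

/-- The hyperbolic (Minkowski) bilinear form `B_h(p,q) = p₀q₀ - p₁q₁` on hyperbolic
numbers identified with points of `ℝ² ≅ ℂ`. -/
def Bh (p q : ℂ) : ℝ := p.re * q.re - p.im * q.im

theorem cos_aux (K : ℕ) (hK : 1 < K) (k m : ℕ) (hk : k < K) (hm : m < K) (hkm : m ≠ k)
    (φ : ℝ) (h1 : -(Real.pi / K) < φ) (h2 : φ < Real.pi / K) :
    Real.cos (φ + (2 * (k : ℝ) * (Real.pi / K) - 2 * (m : ℝ) * (Real.pi / K))) < Real.cos φ := by
  have hK0 : (0 : ℝ) < K := by exact_mod_cast (by omega : 0 < K)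
  have hD : 0 < Real.pi / K := div_pos Real.pi_pos hK0
  have hKD : (K : ℝ) * (Real.pi / K) = Real.pi := by field_simp
  set d := Real.pi / K with hd
  have key : Real.cos φ - Real.cos (φ + (2 * (k : ℝ) * d - 2 * (m : ℝ) * d))
      = 2 * (Real.sin (φ + ((k : ℝ) - m) * d) * Real.sin (((k : ℝ) - m) * d)) := by
    rw [Real.cos_sub_cos,
      show (φ + (φ + (2 * (k : ℝ) * d - 2 * (m : ℝ) * d))) / 2 = φ + ((k : ℝ) - m) * d by ring,
      show (φ - (φ + (2 * (k : ℝ) * d - 2 * (m : ℝ) * d))) / 2 = -(((k : ℝ) - m) * d) by ring,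
      Real.sin_neg]
    ring
  have hm0 : (0 : ℝ) ≤ m := Nat.cast_nonneg m
  have hk0 : (0 : ℝ) ≤ k := Nat.cast_nonneg k
  have hm' : (m : ℝ) + 1 ≤ K := by exact_mod_cast hm
  have hk' : (k : ℝ) + 1 ≤ K := by exact_mod_cast hk
  have pos : 0 < Real.sin (φ + ((k : ℝ) - m) * d) * Real.sin (((k : ℝ) - m) * d) := by
    rcases lt_or_gt_of_ne hkm with h | h
    · have h' : (m : ℝ) + 1 ≤ k := by exact_mod_cast h
      apply mul_pos <;> apply Real.sin_pos_of_pos_of_lt_pi <;> nlinarith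
    · have h' : (k : ℝ) + 1 ≤ m := by exact_mod_cast h
      apply mul_pos_of_neg_of_neg <;> apply Real.sin_neg_of_neg_of_neg_pi_lt <;> nlinarith
  linarith

/-- The function `p ↦ csgn(conj p)` is a `B`-function with respect to the hyperbolic
(Minkowski) bilinear form. -/
theorem csgn_conj_isBFunction_minkowski (K : ℕ) (hK : 1 < K)
    (csgn : ℂ → ℂ) (hcsgn : IsCsgn K csgn)
    (z : ℂ) (hz : (starRingEnd ℂ) z ∈ Dset K)
    (s : ℂ) (hs : s ∈ Sset K) (hne : s ≠ csgn ((starRingEnd ℂ) z)) :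
    Bh s z < Bh (csgn ((starRingEnd ℂ) z)) z := by
  obtain ⟨hc, ha1, ha2⟩ := hcsgn _ hz
  have hw := hz.1
  generalize csgn ((starRingEnd ℂ) z) = c at *
  obtain ⟨k, hk, rfl⟩ := hc
  obtain ⟨m, hm, rfl⟩ := hs
  have hkm : m ≠ k := by rintro rfl; exact hne rfl
  have hcos := cos_aux K hK k m hk hm hkm _ ha1 ha2
  generalize 2 * (k : ℝ) * (Real.pi / K) = γ at *
  generalize 2 * (m : ℝ) * (Real.pi / K) = σ at *
  set u := (starRingEnd ℂ) z * (starRingEnd ℂ) (Complex.exp ((γ : ℂ) * Complex.I)) with hu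
  have hu0 : u ≠ 0 := mul_ne_zero hw (by simp)
  have hr : 0 < ‖u‖ := norm_pos_iff.mpr hu0
  have e1 := Complex.norm_mul_cos_arg u
  have e2 := Complex.norm_mul_sin_arg u
  have f1 : u.re = z.re * Real.cos γ - z.im * Real.sin γ := by
    simp [hu, Complex.exp_ofReal_mul_I_re, Complex.exp_ofReal_mul_I_im]
  have f2 : u.im = -(z.re * Real.sin γ) - z.im * Real.cos γ := by
    simp [hu, Complex.exp_ofReal_mul_I_re, Complex.exp_ofReal_mul_I_im]
    ring
  have hmul := mul_lt_mul_of_pos_left hcos hr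
  have g := Real.sin_sq_add_cos_sq γ
  have hL : ‖u‖ * Real.cos (u.arg + (γ - σ)) = Real.cos σ * z.re - Real.sin σ * z.im := by
    rw [Real.cos_add, mul_sub, ← mul_assoc, ← mul_assoc, e1, e2, f1, f2, Real.cos_sub,
      Real.sin_sub]
    linear_combination (Real.cos σ * z.re - Real.sin σ * z.im) * g
  rw [hL, e1, f1] at hmul
  simp only [Bh, Complex.exp_ofReal_mul_I_re, Complex.exp_ofReal_mul_I_im]
  linarith
end
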